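/- Let F₁, F₂, F₃ : [0,∞) → [0,1) be continuous strictly increasing bijections. For continuous strictly increasing bijections F, G : [0,∞) → [0,1), define F ⊗ G : [0,∞) → [0,1/2) as the inverse of the continuous strictly increasing bijection z ↦ F^{−1}(2z) + G^{−1}(2z) from [0,1/2) onto [0,∞), and define F ⊕ G = max(F, G) pointwise (itself a continuous strictly increasing bijection [0,∞) → [0,1)). Then the distributive law holds: F₃ ⊗ (F₁ ⊕ F₂) = (F₃ ⊗ F₁) ⊕ (F₃ ⊗ F₂), i.e. for every z ∈ [0,∞), (F₃ ⊗ max(F₁,F₂))(z) = max((F₃ ⊗ F₁)(z), (F₃ ⊗ F₂)(z)). -/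

import Mathlib

/-- `F` is a continuous strictly increasing bijection from `[0, ∞)` onto `[0, 1)`. -/
def IsDRCdf (F : ℝ → ℝ) : Prop :=
  StrictMonoOn F (Set.Ici 0) ∧ ContinuousOn F (Set.Ici 0) ∧ F '' Set.Ici 0 = Set.Ico 0 1

/-- `G` is the functional inverse of the bijection `F : [0, ∞) → [0, 1)`. -/
def IsInvOn (G F : ℝ → ℝ) : Prop :=
  (∀ x ∈ Set.Ici (0:ℝ), G (F x) = x) ∧ ∀ w ∈ Set.Ico (0:ℝ) 1, F (G w) = w

/-- `H = F ⊗ G` is the inverse mixing: given the inverses `Finv`, `Ginv` of `F`, `G`,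
`H` is the functional inverse of `z ↦ Finv (2 z) + Ginv (2 z)`, a bijection from
`[0, 1/2)` onto `[0, ∞)`. -/
def IsOtimes (H Finv Ginv : ℝ → ℝ) : Prop :=
  (∀ z ∈ Set.Ici (0:ℝ), H z ∈ Set.Ico (0:ℝ) (1/2) ∧ Finv (2 * H z) + Ginv (2 * H z) = z) ∧
  ∀ w ∈ Set.Ico (0:ℝ) (1/2), H (Finv (2 * w) + Ginv (2 * w)) = w

theorem IsInvOn.exists_eq {F G : ℝ → ℝ} (hF : IsDRCdf F) (hG : IsInvOn G F) {w : ℝ}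
    (hw : w ∈ Set.Ico (0:ℝ) 1) : ∃ x ∈ Set.Ici (0:ℝ), F x = w ∧ G w = x := by
  rw [← hF.2.2] at hw
  obtain ⟨x, hx, rfl⟩ := hw
  exact ⟨x, hx, rfl, hG.1 x hx⟩

theorem IsInvOn.strictMonoOn {F G : ℝ → ℝ} (hF : IsDRCdf F) (hG : IsInvOn G F) :
    StrictMonoOn G (Set.Ico 0 1) := by
  intro v hv w hw hvw
  obtain ⟨x, hx, rfl, hGx⟩ := hG.exists_eq hF hv
  obtain ⟨y, hy, rfl, hGy⟩ := hG.exists_eq hF hw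
  rw [hGx, hGy]
  exact (hF.1.lt_iff_lt hx hy).1 hvw

theorem IsInvOn.max_apply_of_le {F₁ F₂ G₁ G₂ G : ℝ → ℝ} (hF₁ : IsDRCdf F₁) (hF₂ : IsDRCdf F₂)
    (hG₁ : IsInvOn G₁ F₁) (hG₂ : IsInvOn G₂ F₂)
    (hG : IsInvOn G (fun z => max (F₁ z) (F₂ z))) {w : ℝ} (hw : w ∈ Set.Ico (0:ℝ) 1)
    (hle : G₁ w ≤ G₂ w) : G w = G₁ w := by
  obtain ⟨x, hx, hFx, hGx⟩ := hG₁.exists_eq hF₁ hw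
  obtain ⟨y, hy, hFy, hGy⟩ := hG₂.exists_eq hF₂ hw
  rw [hGx, hGy] at hle
  have hF₂x : F₂ x ≤ w := hFy ▸ hF₂.1.monotoneOn hx hy hle
  have h := hG.1 x hx
  simp only [hFx, max_eq_left_iff.2 hF₂x] at h
  rw [h, hGx]

theorem IsOtimes.eq_max_of_le {F₁ F₂ F₃ G₁ G₂ G₃ G₁₂ A B C : ℝ → ℝ}
    (hF₁ : IsDRCdf F₁) (hF₂ : IsDRCdf F₂) (hF₃ : IsDRCdf F₃)
    (hG₁ : IsInvOn G₁ F₁) (hG₂ : IsInvOn G₂ F₂) (hG₃ : IsInvOn G₃ F₃)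
    (hG₁₂ : IsInvOn G₁₂ (fun z => max (F₁ z) (F₂ z)))
    (hA : IsOtimes A G₃ G₁) (hB : IsOtimes B G₃ G₂) (hC : IsOtimes C G₃ G₁₂)
    {z : ℝ} (hz : z ∈ Set.Ici (0:ℝ)) (hle : G₁ (2 * C z) ≤ G₂ (2 * C z)) :
    C z = max (A z) (B z) := by
  obtain ⟨hc, hcz⟩ := hC.1 z hz
  obtain ⟨hb, hbz⟩ := hB.1 z hz
  have hc' : 2 * C z ∈ Set.Ico (0:ℝ) 1 := ⟨by linarith [hc.1], by linarith [hc.2]⟩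
  have hb' : 2 * B z ∈ Set.Ico (0:ℝ) 1 := ⟨by linarith [hb.1], by linarith [hb.2]⟩
  rw [IsInvOn.max_apply_of_le hF₁ hF₂ hG₁ hG₂ hG₁₂ hc' hle] at hcz
  have hAC : A z = C z := by
    have h := hA.2 _ hc
    rwa [hcz] at h
  have hBC : B z ≤ C z := by
    by_contra! hlt
    have h₃ := hG₃.strictMonoOn hF₃ hc' hb' (by linarith)
    have h₂ := hG₂.strictMonoOn hF₂ hc' hb' (by linarith)
    linarith
  rw [hAC, max_eq_left hBC]

theorem stmt_14 (F₁ F₂ F₃ G₁ G₂ G₃ G₁₂ A B C : ℝ → ℝ)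
    (hF₁ : IsDRCdf F₁) (hF₂ : IsDRCdf F₂) (hF₃ : IsDRCdf F₃)
    (hG₁ : IsInvOn G₁ F₁) (hG₂ : IsInvOn G₂ F₂) (hG₃ : IsInvOn G₃ F₃)
    (hG₁₂ : IsInvOn G₁₂ (fun z => max (F₁ z) (F₂ z)))
    (hA : IsOtimes A G₃ G₁) (hB : IsOtimes B G₃ G₂) (hC : IsOtimes C G₃ G₁₂) :
    ∀ z ∈ Set.Ici (0:ℝ), C z = max (A z) (B z) := by
  intro z hz
  rcases le_total (G₁ (2 * C z)) (G₂ (2 * C z)) with hle | hle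
  · exact IsOtimes.eq_max_of_le hF₁ hF₂ hF₃ hG₁ hG₂ hG₃ hG₁₂ hA hB hC hz hle
  · simp only [max_comm (F₁ _)] at hG₁₂
    rw [max_comm]
    exact IsOtimes.eq_max_of_le hF₂ hF₁ hF₃ hG₂ hG₁ hG₃ hG₁₂ hB hA hC hz hle
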